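/- arXiv:2105.02301 — 4 statements merged into one kernel-verified Lean document; each statement's English description precedes it below -/
import Mathlib

section
/- In a transfer setup in which V carries an R-bilinear product *, with |G| invertible in R: if E ∈ V is a two-sided unit for * (E * x = x * E = x for all x ∈ V) and E is G-invariant (g·E = E for all g ∈ G), then e := |G|⁻² · q(E) is a two-sided unit for the transfer product, i.e. P(e,a) = P(a,e) = a for all a ∈ W. -/
/-- **The transfer product is unital.**
In a transfer setup ((T1): `q ∘ t = |G| • id`, (T2): `t ∘ q = ∑ g, ρ g`) in which
`V` carries an `R`-bilinear product `mul`, with `|G|` invertible in `R`: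
if `E : V` is a two-sided unit for `mul` and `E` is `G`-invariant, then
`e := |G|⁻² • q E` is a two-sided unit for the transfer product
`P a b := q (mul (t a) (t b))` on `W`. -/
theorem transfer_product_unital
    {R : Type*} [CommRing R] {G : Type*} [Group G] [Fintype G]
    {V W : Type*} [AddCommGroup V] [Module R V] [AddCommGroup W] [Module R W]
    (ρ : Representation R G V) (q : V →ₗ[R] W) (t : W →ₗ[R] V)
    (hT1 : q ∘ₗ t = (Fintype.card G : R) • LinearMap.id)
    (hT2 : t ∘ₗ q = ∑ g : G, ρ g)
    (hcard : IsUnit ((Fintype.card G : R)))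
    (mul : V →ₗ[R] V →ₗ[R] V)
    (E : V)
    (hE_left : ∀ x : V, mul E x = x)
    (hE_right : ∀ x : V, mul x E = x)
    (hE_inv : ∀ g : G, ρ g E = E) :
    ∀ a : W,
      q (mul (t ((Ring.inverse (Fintype.card G : R)) ^ 2 • q E)) (t a)) = a ∧
      q (mul (t a) (t ((Ring.inverse (Fintype.card G : R)) ^ 2 • q E))) = a := by
  have hqt (a : W) : q (t a) = (Fintype.card G : R) • a := by
    simpa using LinearMap.congr_fun hT1 a
  have htq : t (q E) = (Fintype.card G : R) • E := by
    have h := LinearMap.congr_fun hT2 E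
    simpa [LinearMap.sum_apply, hE_inv, Nat.cast_smul_eq_nsmul] using h
  have hinv : Ring.inverse (Fintype.card G : R) ^ 2 * Fintype.card G * Fintype.card G = 1 := by
    rw [mul_assoc, ← sq, ← mul_pow, Ring.inverse_mul_cancel _ hcard, one_pow]
  intro a
  constructor <;>
    simp only [map_smul, LinearMap.smul_apply, htq, hE_left, hE_right, hqt, smul_smul, hinv,
      one_smul]
end

section
/- In a transfer setup in which V carries an R-bilinear product *, suppose V' is an R-module with an R-bilinear product •, f : V → V' is an R-linear map that is multiplicative (f(x*y) = f(x)•f(y) for all x,y ∈ V), and F : W → V' is an R-linear map with F ∘ q = f. Then for all a, b ∈ W one has F(P(a,b)) = |G|² · (F(a) • F(b)). -/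
/-- **Homomorphisms factoring through `q` are multiplicative up to the scaling `|G|²`.**
In a transfer setup ((T1): `q ∘ t = |G| • id`, (T2): `t ∘ q = ∑ g, ρ g`) in which
`V` carries an `R`-bilinear product `mul`, suppose `V'` is an `R`-module with an
`R`-bilinear product `bul`, `f : V → V'` is `R`-linear and multiplicative, and
`F : W → V'` is `R`-linear with `F ∘ q = f`. Then for the transfer product
`P a b := q (mul (t a) (t b))` one has `F (P a b) = |G|² • (bul (F a) (F b))`. -/
theorem factoring_hom_multiplicative_up_to_scaling
    {R : Type*} [CommRing R] {G : Type*} [Group G] [Fintype G]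
    {V W V' : Type*} [AddCommGroup V] [Module R V] [AddCommGroup W] [Module R W]
    [AddCommGroup V'] [Module R V']
    (ρ : Representation R G V) (q : V →ₗ[R] W) (t : W →ₗ[R] V)
    (hT1 : q ∘ₗ t = (Fintype.card G : R) • LinearMap.id)
    (hT2 : t ∘ₗ q = ∑ g : G, ρ g)
    (mul : V →ₗ[R] V →ₗ[R] V)
    (bul : V' →ₗ[R] V' →ₗ[R] V')
    (f : V →ₗ[R] V') (F : W →ₗ[R] V')
    (hf_mul : ∀ x y : V, f (mul x y) = bul (f x) (f y))
    (hFq : F ∘ₗ q = f) :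
    ∀ a b : W,
      F (q (mul (t a) (t b))) = ((Fintype.card G : R)) ^ 2 • bul (F a) (F b) := by
  have hq (x : V) : F (q x) = f x := LinearMap.congr_fun hFq x
  have hft (a : W) : f (t a) = (Fintype.card G : R) • F a := by
    have h : q (t a) = (Fintype.card G : R) • a := LinearMap.congr_fun hT1 a
    rw [← hq, h, map_smul]
  intro a b
  rw [hq, hf_mul, hft, hft, map_smul, map_smul, LinearMap.smul_apply, smul_smul, sq]
end

section
/- Let (V, *, q, t, W) and (V', ⋆, q', t', W') be two transfer setups for the same finite group G over the same commutative ring R, with |G| invertible in R, both G-actions multiplicative, and let j : V → V' be an R-linear map that is multiplicative (j(x*y) = j(x)⋆j(y)) and G-equivariant (j(g·x) = g·j(x) for all g, x). Define J : W → W' by J := |G|⁻¹ · (q' ∘ j ∘ t). Then J intertwines the transfer products: J(P(a,b)) = P'(J(a), J(b)) for all a, b ∈ W. -/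
/-- **Equivariant multiplicative maps induce homomorphisms of transfer products.**
Given two transfer setups `(V, mul, ρ, q, t, W)` and `(V', mul', ρ', q', t', W')`
for the same finite group `G` over `R`, with `|G|` invertible in `R`, both
actions multiplicative, and `j : V → V'` an `R`-linear, multiplicative,
`G`-equivariant map, the map `J := |G|⁻¹ • (q' ∘ j ∘ t)` intertwines the transfer
products: `J (P a b) = P' (J a) (J b)` for all `a b : W`, where
`P a b := q (mul (t a) (t b))` and `P' a' b' := q' (mul' (t' a') (t' b'))`. -/
theorem equivariant_map_induces_transfer_hom
    {R : Type*} [CommRing R] {G : Type*} [Group G] [Fintype G]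
    {V W V' W' : Type*} [AddCommGroup V] [Module R V] [AddCommGroup W] [Module R W]
    [AddCommGroup V'] [Module R V'] [AddCommGroup W'] [Module R W']
    (ρ : Representation R G V) (q : V →ₗ[R] W) (t : W →ₗ[R] V)
    (hT1 : q ∘ₗ t = (Fintype.card G : R) • LinearMap.id)
    (hT2 : t ∘ₗ q = ∑ g : G, ρ g)
    (ρ' : Representation R G V') (q' : V' →ₗ[R] W') (t' : W' →ₗ[R] V')
    (hT1' : q' ∘ₗ t' = (Fintype.card G : R) • LinearMap.id)
    (hT2' : t' ∘ₗ q' = ∑ g : G, ρ' g)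
    (hcard : IsUnit ((Fintype.card G : R)))
    (mul : V →ₗ[R] V →ₗ[R] V)
    (mul' : V' →ₗ[R] V' →ₗ[R] V')
    (hmul : ∀ (g : G) (x y : V), ρ g (mul x y) = mul (ρ g x) (ρ g y))
    (hmul' : ∀ (g : G) (x y : V'), ρ' g (mul' x y) = mul' (ρ' g x) (ρ' g y))
    (j : V →ₗ[R] V')
    (hj_mul : ∀ x y : V, j (mul x y) = mul' (j x) (j y))
    (hj_equiv : ∀ (g : G) (x : V), j (ρ g x) = ρ' g (j x))
    (J : W → W')
    (hJ : ∀ a : W, J a = Ring.inverse (Fintype.card G : R) • q' (j (t a))) :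
    ∀ a b : W,
      J (q (mul (t a) (t b))) = q' (mul' (t' (J a)) (t' (J b))) := by
  have hsq : ∀ x : V, j (t (q x)) = t' (q' (j x)) := fun x => by
    have h := LinearMap.congr_fun hT2 x
    have h' := LinearMap.congr_fun hT2' (j x)
    simp only [LinearMap.comp_apply, LinearMap.sum_apply] at h h'
    simp only [h, h', map_sum, hj_equiv]
  have hqt : ∀ a : W, q (t a) = (Fintype.card G : R) • a := fun a => by
    simpa using LinearMap.congr_fun hT1 a
  have hqt' : ∀ a : W', q' (t' a) = (Fintype.card G : R) • a := fun a => by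
    simpa using LinearMap.congr_fun hT1' a
  have hJq : ∀ x : V, J (q x) = q' (j x) := fun x => by
    rw [hJ, hsq, hqt', smul_smul, Ring.inverse_mul_cancel _ hcard, one_smul]
  have htJ : ∀ a : W, t' (J a) = j (t a) := fun a => by
    rw [hJ, map_smul, ← hsq, hqt, map_smul, map_smul, smul_smul,
      Ring.inverse_mul_cancel _ hcard, one_smul]
  intro a b
  rw [hJq, hj_mul, htJ, htJ]
end

section
/- Let (V, *) be an R-module with an R-bilinear product * and a multiplicative action of a finite group G by R-linear automorphisms, over a commutative ring R in which |G| is invertible. Suppose (W, q, t) and (W', q', t') are two transfer setups for this same action. Then the R-linear map Φ := |G|⁻¹ · (q' ∘ t) : W → W' is bijective, its inverse is |G|⁻¹ · (q ∘ t'), and Φ intertwines the two transfer products: Φ(P(a,b)) = P'(Φ(a), Φ(b)) for all a, b ∈ W. -/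
/-- If `q ∘ t` and `q' ∘ t'` are multiplication by a unit `n` and `t ∘ q = t' ∘ q'`, then
`t'` sends `n⁻¹ • q' (t a)` to `t a`. -/
theorem transfer_inverse_smul_apply {R V W W' : Type*} [CommRing R]
    [AddCommGroup V] [Module R V] [AddCommGroup W] [Module R W]
    [AddCommGroup W'] [Module R W'] {n : R} (hn : IsUnit n)
    {q : V →ₗ[R] W} {t : W →ₗ[R] V} {q' : V →ₗ[R] W'} {t' : W' →ₗ[R] V}
    (hqt : ∀ a, q (t a) = n • a) (htq : ∀ v, t (q v) = t' (q' v)) (a : W) :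
    t' (Ring.inverse n • q' (t a)) = t a := by
  rw [map_smul, ← htq, hqt, map_smul, smul_smul, Ring.inverse_mul_cancel n hn, one_smul]

/-- **Two transfer setups for the same action yield isomorphic transfer products.**
Let `(V, mul)` carry a multiplicative `G`-action `ρ` by `R`-linear automorphisms,
with `|G|` invertible in `R`, and let `(W, q, t)` and `(W', q', t')` be two
transfer setups for this action. Then `Φ := |G|⁻¹ • (q' ∘ t) : W → W'` is
bijective, its inverse is `Ψ := |G|⁻¹ • (q ∘ t')`, and `Φ` intertwines the two
transfer products: `Φ (P a b) = P' (Φ a) (Φ b)` for all `a b : W`, where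
`P a b := q (mul (t a) (t b))` and `P' a' b' := q' (mul' (t' a') (t' b'))`. -/
theorem transfer_products_isomorphic
    {R : Type*} [CommRing R] {G : Type*} [Group G] [Fintype G]
    {V W W' : Type*} [AddCommGroup V] [Module R V] [AddCommGroup W] [Module R W]
    [AddCommGroup W'] [Module R W']
    (ρ : Representation R G V)
    (mul : V →ₗ[R] V →ₗ[R] V)
    (hmul : ∀ (g : G) (x y : V), ρ g (mul x y) = mul (ρ g x) (ρ g y))
    (hcard : IsUnit ((Fintype.card G : R)))
    (q : V →ₗ[R] W) (t : W →ₗ[R] V)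
    (hT1 : q ∘ₗ t = (Fintype.card G : R) • LinearMap.id)
    (hT2 : t ∘ₗ q = ∑ g : G, ρ g)
    (q' : V →ₗ[R] W') (t' : W' →ₗ[R] V)
    (hT1' : q' ∘ₗ t' = (Fintype.card G : R) • LinearMap.id)
    (hT2' : t' ∘ₗ q' = ∑ g : G, ρ g)
    (Φ : W → W') (Ψ : W' → W)
    (hΦ : ∀ a : W, Φ a = Ring.inverse (Fintype.card G : R) • q' (t a))
    (hΨ : ∀ a' : W', Ψ a' = Ring.inverse (Fintype.card G : R) • q (t' a')) :
    Function.Bijective Φ ∧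
    (∀ a : W, Ψ (Φ a) = a) ∧
    (∀ a' : W', Φ (Ψ a') = a') ∧
    (∀ a b : W,
      Φ (q (mul (t a) (t b))) = q' (mul (t' (Φ a)) (t' (Φ b)))) := by
  have hqt (a : W) : q (t a) = (Fintype.card G : R) • a := LinearMap.congr_fun hT1 a
  have hqt' (a : W') : q' (t' a) = (Fintype.card G : R) • a := LinearMap.congr_fun hT1' a
  have htq (v : V) : t (q v) = t' (q' v) := LinearMap.congr_fun (hT2.trans hT2'.symm) v
  have htΦ (a : W) : t' (Φ a) = t a := by
    rw [hΦ, transfer_inverse_smul_apply hcard hqt htq]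
  have htΨ (a : W') : t (Ψ a) = t' a := by
    rw [hΨ, transfer_inverse_smul_apply hcard hqt' fun v => (htq v).symm]
  have hΨΦ (a : W) : Ψ (Φ a) = a := by
    rw [hΨ, htΦ, hqt, smul_smul, Ring.inverse_mul_cancel _ hcard, one_smul]
  have hΦΨ (a : W') : Φ (Ψ a) = a := by
    rw [hΦ, htΨ, hqt', smul_smul, Ring.inverse_mul_cancel _ hcard, one_smul]
  refine ⟨Function.bijective_iff_has_inverse.mpr ⟨Ψ, hΨΦ, hΦΨ⟩, hΨΦ, hΦΨ, fun a b => ?_⟩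
  rw [htΦ, htΦ, hΦ, htq, hqt', smul_smul, Ring.inverse_mul_cancel _ hcard, one_smul]
end
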